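/- Let G = (V, E) be a finite graph, let M be a maximal matching of G, let X ⊆ V be a shattered set, and suppose some vertex x ∈ X is not covered by M. Then every neighbor of x is covered by M, and consequently 2|M| ≥ 2^{|X| − 1} − 1. -/

import Mathlib

/-- The closed neighborhood `N[v]` of a vertex `v` in a simple graph. -/
def closedNbhd {V : Type*} (G : SimpleGraph V) (v : V) : Set V :=
  insert v (G.neighborSet v)

/-- A set `X` of vertices is shattered if every subset of `X` is the trace
`N[v] ∩ X` of the closed neighborhood of some vertex `v`. -/
def Shattered {V : Type*} (G : SimpleGraph V) (X : Set V) : Prop :=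
  ∀ Y ⊆ X, ∃ v, closedNbhd G v ∩ X = Y

/-- A matching: a set of edges of `G` that are pairwise vertex-disjoint. -/
def IsMatchingSet {V : Type*} (G : SimpleGraph V) (M : Set (Sym2 V)) : Prop :=
  M ⊆ G.edgeSet ∧ ∀ e ∈ M, ∀ f ∈ M, e ≠ f → ∀ v : V, ¬(v ∈ e ∧ v ∈ f)

/-- A matching is maximal if no edge of `G` can be added to it while keeping
it a matching. -/
def MaximalMatchingSet {V : Type*} (G : SimpleGraph V) (M : Set (Sym2 V)) : Prop :=
  IsMatchingSet G M ∧ ∀ e ∈ G.edgeSet, e ∉ M → ¬ IsMatchingSet G (insert e M)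

theorem mem_closedNbhd_comm {V : Type*} {G : SimpleGraph V} {v w : V} :
    v ∈ closedNbhd G w ↔ w ∈ closedNbhd G v := by
  simp [closedNbhd, eq_comm, G.adj_comm]

/-- An edge with both endpoints uncovered can be added to a matching, so a maximal matching
covers every neighbor of an uncovered vertex. -/
theorem MaximalMatchingSet.exists_mem_of_adj {V : Type*} {G : SimpleGraph V} {M : Set (Sym2 V)}
    (hM : MaximalMatchingSet G M) {x y : V} (hxM : ∀ e ∈ M, x ∉ e) (hxy : G.Adj x y) :
    ∃ e ∈ M, y ∈ e := by
  by_contra! hyM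
  refine hM.2 s(x, y) hxy (fun h => hxM _ h (Sym2.mem_mk_left x y))
    ⟨Set.insert_subset hxy hM.1.1, ?_⟩
  rintro e (rfl | he) f (rfl | hf) hef v ⟨hve, hvf⟩
  · exact hef rfl
  · rcases Sym2.mem_iff.1 hve with rfl | rfl
    · exact hxM f hf hvf
    · exact hyM f hf hvf
  · rcases Sym2.mem_iff.1 hvf with rfl | rfl
    · exact hxM e he hve
    · exact hyM e he hve
  · exact hM.1.2 e he f hf hef v ⟨hve, hvf⟩

/-- A finite set `M` of unordered pairs covers at most `2 * |M|` points. -/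
theorem ncard_covered_le {V : Type*} [Finite V] (M : Set (Sym2 V)) :
    {v | ∃ e ∈ M, v ∈ e}.ncard ≤ 2 * M.ncard := by
  classical
  have := Fintype.ofFinite V
  have hC : {v | ∃ e ∈ M, v ∈ e} = (M.toFinset.biUnion Sym2.toFinset : Finset V) := by
    ext v
    simp
  rw [hC, Set.ncard_coe_finset, Set.ncard_eq_toFinset_card', mul_comm]
  refine Finset.card_biUnion_le_card_mul _ _ _ fun e _ => ?_
  rw [Sym2.card_toFinset]
  split_ifs <;> simp

/-- A vertex of a shattered set `X` has at least `2 ^ (|X| - 1)` vertices in its closed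
neighborhood, one for each subset of `X` containing it. -/
theorem Shattered.two_pow_le_ncard_closedNbhd {V : Type*} [Finite V] {G : SimpleGraph V}
    {X : Set V} (hX : Shattered G X) {x : V} (hx : x ∈ X) :
    2 ^ (X.ncard - 1) ≤ (closedNbhd G x).ncard := by
  have hsub : 𝒫 (X \ {x}) ⊆ (fun v => (closedNbhd G v ∩ X) \ {x}) '' closedNbhd G x := by
    intro Y hY
    obtain ⟨v, hv⟩ := hX (insert x Y) (Set.insert_subset hx (hY.trans Set.sdiff_subset))
    have hxv : x ∈ closedNbhd G v ∩ X := hv ▸ Set.mem_insert x Y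
    refine ⟨v, mem_closedNbhd_comm.1 hxv.1, ?_⟩
    simp only [hv]
    exact Set.insert_sdiff_self_of_notMem fun h => (hY h).2 rfl
  calc 2 ^ (X.ncard - 1) = (𝒫 (X \ {x})).ncard := by
        rw [Set.ncard_powerset, Set.ncard_sdiff_singleton_of_mem hx]
    _ ≤ _ := Set.ncard_le_ncard hsub
    _ ≤ _ := Set.ncard_image_le

theorem stmt_7 {V : Type*} [Fintype V] (G : SimpleGraph V)
    (M : Set (Sym2 V)) (hM : MaximalMatchingSet G M)
    (X : Set V) (hX : Shattered G X)
    (x : V) (hx : x ∈ X) (hxM : ∀ e ∈ M, x ∉ e) :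
    (∀ y : V, G.Adj x y → ∃ e ∈ M, y ∈ e) ∧
      2 ^ (X.ncard - 1) - 1 ≤ 2 * M.ncard := by
  have hcov : ∀ y : V, G.Adj x y → ∃ e ∈ M, y ∈ e := fun y hxy => hM.exists_mem_of_adj hxM hxy
  refine ⟨hcov, Nat.sub_le_iff_le_add.2 ?_⟩
  calc 2 ^ (X.ncard - 1) ≤ (closedNbhd G x).ncard := hX.two_pow_le_ncard_closedNbhd hx
    _ ≤ (G.neighborSet x).ncard + 1 := Set.ncard_insert_le _ _
    _ ≤ {v | ∃ e ∈ M, v ∈ e}.ncard + 1 := Nat.add_le_add_right (Set.ncard_le_ncard hcov) 1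
    _ ≤ 2 * M.ncard + 1 := Nat.add_le_add_right (ncard_covered_le M) 1
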